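/- Let G be a finite Bayesian game and (f,g,Q) a communication equilibrium of G such that the correlation Q is belief-invariant. Then its canonical representative Q̂ is belief-invariant, Q̂ is a canonical communication equilibrium of G, and for every player i, ∑_{t,a} P(t) Q̂(a|t) v_i(t,a) = ⟨v_i⟩. -/

import Mathlib

open Finset

/-- A correlation: nonnegative entries, and for each input profile the outputs
form a probability distribution. -/
def IsCorrelation {ι : Type} [Fintype ι] [DecidableEq ι] {R S : ι → Type}
    [∀ i, Fintype (S i)]
    (Q : (∀ i, R i) → (∀ i, S i) → ℝ) : Prop :=
  (∀ r s, 0 ≤ Q r s) ∧ ∀ r, ∑ s : ∀ i, S i, Q r s = 1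

/-- A correlation is belief-invariant (non-signalling) if for every subset `I` of the
players the joint marginal distribution of the outputs of the players in `I` depends
only on the inputs of the players in `I`. -/
def IsBeliefInvariant {ι : Type} [Fintype ι] [DecidableEq ι] {R S : ι → Type}
    [∀ i, Fintype (S i)] [∀ i, DecidableEq (S i)]
    (Q : (∀ i, R i) → (∀ i, S i) → ℝ) : Prop :=
  ∀ (I : Finset ι) (r r' : ∀ i, R i), (∀ i ∈ I, r i = r' i) →
    ∀ s₀ : ∀ i, S i,
      (∑ s : ∀ i, S i, if ∀ i ∈ I, s i = s₀ i then Q r s else 0) =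
      (∑ s : ∀ i, S i, if ∀ i ∈ I, s i = s₀ i then Q r' s else 0)

/-- A correlation `Q` with inputs the types and outputs the actions is a canonical
communication equilibrium: no player `i` of type `ti` gains by reporting `ri` instead
and transforming the recommended action by `α`. -/
def IsCanonCommEq {ι : Type} [Fintype ι] [DecidableEq ι] {T A : ι → Type}
    [∀ i, Fintype (T i)] [∀ i, Fintype (A i)] [∀ i, DecidableEq (T i)]
    (P : (∀ i, T i) → ℝ) (v : ι → (∀ i, T i) → (∀ i, A i) → ℝ)
    (Q : (∀ i, T i) → (∀ i, A i) → ℝ) : Prop :=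
  ∀ (i : ι) (ti ri : T i) (α : A i → A i),
    (∑ t : ∀ j, T j, ∑ a : ∀ j, A j,
      if t i = ti then P t * Q t a * v i t a else 0) ≥
    ∑ t : ∀ j, T j, ∑ a : ∀ j, A j,
      if t i = ti then
        P t * Q (Function.update t i ri) a * v i t (Function.update a i (α (a i)))
      else 0

/-- Expected payoff of player `i` in the solution `(f, g, Q)` of the Bayesian game
with prior `P`, payoffs `v` and local randomness distributions `μ`. -/
noncomputable def expPayoff {ι : Type} [Fintype ι] [DecidableEq ι]
    {T A R S Λ : ι → Type}
    [∀ i, Fintype (T i)] [∀ i, Fintype (S i)] [∀ i, Fintype (Λ i)]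
    (P : (∀ i, T i) → ℝ) (v : ι → (∀ i, T i) → (∀ i, A i) → ℝ)
    (μ : ∀ i, Λ i → ℝ)
    (f : ∀ i, T i → Λ i → R i) (g : ∀ i, T i → S i → Λ i → A i)
    (Q : (∀ i, R i) → (∀ i, S i) → ℝ) (i : ι) : ℝ :=
  ∑ t : ∀ j, T j, ∑ lam : ∀ j, Λ j, ∑ s : ∀ j, S j,
    P t * (∏ j, μ j (lam j)) * Q (fun j => f j (t j) (lam j)) s *
      v i t (fun j => g j (t j) (s j) (lam j))

/-- Expected payoff of player `i` when he unilaterally deviates to `(φ, χ)`. -/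
noncomputable def devPayoff {ι : Type} [Fintype ι] [DecidableEq ι]
    {T A R S Λ : ι → Type}
    [∀ i, Fintype (T i)] [∀ i, Fintype (S i)] [∀ i, Fintype (Λ i)]
    (P : (∀ i, T i) → ℝ) (v : ι → (∀ i, T i) → (∀ i, A i) → ℝ)
    (μ : ∀ i, Λ i → ℝ)
    (f : ∀ i, T i → Λ i → R i) (g : ∀ i, T i → S i → Λ i → A i)
    (Q : (∀ i, R i) → (∀ i, S i) → ℝ) (i : ι)
    (φ : T i → Λ i → R i) (χ : T i → S i → Λ i → A i) : ℝ :=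
  ∑ t : ∀ j, T j, ∑ lam : ∀ j, Λ j, ∑ s : ∀ j, S j,
    P t * (∏ j, μ j (lam j)) *
      Q (Function.update (fun j => f j (t j) (lam j)) i (φ (t i) (lam i))) s *
      v i t (Function.update (fun j => g j (t j) (s j) (lam j)) i (χ (t i) (s i) (lam i)))

/-- `(f,g,Q)` is a communication equilibrium: no player can profit by a unilateral
deviation `(φ, χ)`. -/
def IsCommEq {ι : Type} [Fintype ι] [DecidableEq ι]
    {T A R S Λ : ι → Type}
    [∀ i, Fintype (T i)] [∀ i, Fintype (S i)] [∀ i, Fintype (Λ i)]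
    (P : (∀ i, T i) → ℝ) (v : ι → (∀ i, T i) → (∀ i, A i) → ℝ)
    (μ : ∀ i, Λ i → ℝ)
    (f : ∀ i, T i → Λ i → R i) (g : ∀ i, T i → S i → Λ i → A i)
    (Q : (∀ i, R i) → (∀ i, S i) → ℝ) : Prop :=
  ∀ (i : ι) (φ : T i → Λ i → R i) (χ : T i → S i → Λ i → A i),
    expPayoff P v μ f g Q i ≥ devPayoff P v μ f g Q i φ χ

/-- The canonical representative `Q̂` of the solution `(f,g,Q)`:
`Q̂(a|t) = ∑_λ Λ(λ) ∑_{s : g(t,s,λ) = a} Q(s | f(t,λ))`. -/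
noncomputable def canonRep {ι : Type} [Fintype ι] [DecidableEq ι]
    {T A R S Λ : ι → Type}
    [∀ i, Fintype (S i)] [∀ i, Fintype (Λ i)] [∀ i, DecidableEq (A i)]
    (μ : ∀ i, Λ i → ℝ)
    (f : ∀ i, T i → Λ i → R i) (g : ∀ i, T i → S i → Λ i → A i)
    (Q : (∀ i, R i) → (∀ i, S i) → ℝ) :
    (∀ i, T i) → (∀ i, A i) → ℝ :=
  fun t a =>
    ∑ lam : ∀ j, Λ j, (∏ j, μ j (lam j)) *
      ∑ s : ∀ j, S j,
        if ∀ j, g j (t j) (s j) (lam j) = a j then Q (fun j => f j (t j) (lam j)) s else 0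

/-- Expectation of a function of the actions under the canonical representative. -/
lemma sum_canonRep_mul {ι : Type} [Fintype ι] [DecidableEq ι]
    {T A R S Λ : ι → Type}
    [∀ i, Fintype (A i)] [∀ i, DecidableEq (A i)] [∀ i, Fintype (S i)] [∀ i, Fintype (Λ i)]
    (μ : ∀ i, Λ i → ℝ)
    (f : ∀ i, T i → Λ i → R i) (g : ∀ i, T i → S i → Λ i → A i)
    (Q : (∀ i, R i) → (∀ i, S i) → ℝ) (t : ∀ i, T i) (h : (∀ i, A i) → ℝ) :
    ∑ a : ∀ j, A j, canonRep μ f g Q t a * h a =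
      ∑ lam : ∀ j, Λ j, (∏ j, μ j (lam j)) * ∑ s : ∀ j, S j,
        Q (fun j => f j (t j) (lam j)) s * h (fun j => g j (t j) (s j) (lam j)) := by
  simp only [canonRep, Finset.sum_mul]
  rw [Finset.sum_comm]
  refine Finset.sum_congr rfl fun lam _ => ?_
  simp only [mul_assoc]
  rw [← Finset.mul_sum]
  congr 1
  simp only [Finset.sum_mul]
  rw [Finset.sum_comm]
  refine Finset.sum_congr rfl fun s _ => ?_
  simp only [← funext_iff, ite_mul, zero_mul]
  rw [Finset.sum_ite_eq]
  simp

/-- Under a belief-invariant correlation, the expectation of a function of the outputs of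
the players in `I` depends only on the inputs of the players in `I`. -/
lemma IsBeliefInvariant.sum_mul_eq {ι : Type} [Fintype ι] [DecidableEq ι] {R S : ι → Type}
    [∀ i, Fintype (S i)] [∀ i, DecidableEq (S i)]
    {Q : (∀ i, R i) → (∀ i, S i) → ℝ} (hQ : IsBeliefInvariant Q)
    {I : Finset ι} {r r' : ∀ i, R i} (hr : ∀ i ∈ I, r i = r' i)
    {h : (∀ i, S i) → ℝ} (hh : ∀ s s', (∀ i ∈ I, s i = s' i) → h s = h s') :
    ∑ s, Q r s * h s = ∑ s, Q r' s * h s := by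
  rcases isEmpty_or_nonempty (∀ i, S i) with _ | ⟨⟨b⟩⟩
  · simp
  let p : (∀ i, S i) → ∀ i, S i := fun s i => if i ∈ I then s i else b i
  have hp : ∀ s, ∀ i ∈ I, s i = p s i := fun s i hi => by simp [p, hi]
  have hfib : ∀ s w, p s = p w ↔ ∀ i ∈ I, s i = w i := by
    intro s w
    refine ⟨fun hs i hi => ?_, fun hs => ?_⟩
    · rw [hp s i hi, hp w i hi, hs]
    · funext i
      by_cases hi : i ∈ I
      · simp [p, hi, hs i hi]
      · simp [p, hi]
  have key : ∀ x : ∀ i, R i, ∑ s, Q x s * h s =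
      ∑ u, (∑ s, if p s = u then Q x s else 0) * h u := by
    intro x
    simp only [Finset.sum_mul]
    rw [Finset.sum_comm]
    refine Finset.sum_congr rfl fun s _ => ?_
    simp only [ite_mul, zero_mul]
    rw [Finset.sum_ite_eq]
    simp [hh s (p s) (hp s)]
  rw [key, key]
  refine Finset.sum_congr rfl fun u _ => ?_
  congr 1
  by_cases hu : ∃ w, p w = u
  · obtain ⟨w, rfl⟩ := hu
    simpa only [hfib] using hQ I r r' hr w
  · have hne : ∀ s, p s ≠ u := fun s hs => hu ⟨s, hs⟩
    simp [hne]

/-- The canonical representative of a belief-invariant solution is belief-invariant. -/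
lemma IsBeliefInvariant.canonRep {ι : Type} [Fintype ι] [DecidableEq ι]
    {T A R S Λ : ι → Type}
    [∀ i, Fintype (A i)] [∀ i, DecidableEq (A i)]
    [∀ i, Fintype (S i)] [∀ i, DecidableEq (S i)] [∀ i, Fintype (Λ i)]
    (μ : ∀ i, Λ i → ℝ)
    (f : ∀ i, T i → Λ i → R i) (g : ∀ i, T i → S i → Λ i → A i)
    {Q : (∀ i, R i) → (∀ i, S i) → ℝ} (hQ : IsBeliefInvariant Q) :
    IsBeliefInvariant (canonRep μ f g Q) := by
  intro I t t' ht a₀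
  have hsum := fun x => sum_canonRep_mul μ f g Q x
    (fun a => if ∀ i ∈ I, a i = a₀ i then (1 : ℝ) else 0)
  simp only [mul_ite, mul_one, mul_zero] at hsum
  rw [hsum t, hsum t']
  refine Finset.sum_congr rfl fun lam _ => ?_
  congr 1
  have hmarg := hQ.sum_mul_eq (I := I)
    (r := fun j => f j (t j) (lam j)) (r' := fun j => f j (t' j) (lam j))
    (fun i hi => by simp only [ht i hi])
    (h := fun s => if ∀ i ∈ I, g i (t i) (s i) (lam i) = a₀ i then (1 : ℝ) else 0)
    (fun s s' hs => by
      have hiff : (∀ i ∈ I, g i (t i) (s i) (lam i) = a₀ i) ↔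
          ∀ i ∈ I, g i (t i) (s' i) (lam i) = a₀ i :=
        forall₂_congr fun i hi => by rw [hs i hi]
      simp only [hiff])
  simp only [mul_ite, mul_one, mul_zero] at hmarg
  rw [hmarg]
  refine Finset.sum_congr rfl fun s _ => ?_
  have hiff : (∀ i ∈ I, g i (t i) (s i) (lam i) = a₀ i) ↔
      ∀ i ∈ I, g i (t' i) (s i) (lam i) = a₀ i :=
    forall₂_congr fun i hi => by rw [ht i hi]
  simp only [hiff]

/-- The expected payoff, computed type profile by type profile from the canonical
representative. -/
lemma expPayoff_eq_sum_canonRep {ι : Type} [Fintype ι] [DecidableEq ι]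
    {T A R S Λ : ι → Type} [∀ i, Fintype (T i)]
    [∀ i, Fintype (A i)] [∀ i, DecidableEq (A i)] [∀ i, Fintype (S i)] [∀ i, Fintype (Λ i)]
    (P : (∀ i, T i) → ℝ) (v : ι → (∀ i, T i) → (∀ i, A i) → ℝ)
    (μ : ∀ i, Λ i → ℝ)
    (f : ∀ i, T i → Λ i → R i) (g : ∀ i, T i → S i → Λ i → A i)
    (Q : (∀ i, R i) → (∀ i, S i) → ℝ) (i : ι) :
    expPayoff P v μ f g Q i =
      ∑ t : ∀ j, T j, ∑ a : ∀ j, A j, P t * canonRep μ f g Q t a * v i t a := by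
  refine Finset.sum_congr rfl fun t _ => ?_
  simp only [mul_assoc]
  rw [← Finset.mul_sum, sum_canonRep_mul]
  simp only [Finset.mul_sum]

/-- The payoff of player `i` when, at type `ti` only, he behaves as if his type were `ri`
and transforms the resulting action by `α`. -/
lemma devPayoff_misreport {ι : Type} [Fintype ι] [DecidableEq ι]
    {T A R S Λ : ι → Type} [∀ i, Fintype (T i)] [∀ i, DecidableEq (T i)]
    [∀ i, Fintype (A i)] [∀ i, DecidableEq (A i)] [∀ i, Fintype (S i)] [∀ i, Fintype (Λ i)]
    (P : (∀ i, T i) → ℝ) (v : ι → (∀ i, T i) → (∀ i, A i) → ℝ)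
    (μ : ∀ i, Λ i → ℝ)
    (f : ∀ i, T i → Λ i → R i) (g : ∀ i, T i → S i → Λ i → A i)
    (Q : (∀ i, R i) → (∀ i, S i) → ℝ) (i : ι) (ti ri : T i) (α : A i → A i) :
    devPayoff P v μ f g Q i (fun x l => if x = ti then f i ri l else f i x l)
        (fun x s l => if x = ti then α (g i ri s l) else g i x s l) =
      ∑ t : ∀ j, T j, ∑ a : ∀ j, A j,
        if t i = ti then
          P t * canonRep μ f g Q (Function.update t i ri) a *
            v i t (Function.update a i (α (a i)))
        else P t * canonRep μ f g Q t a * v i t a := by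
  refine Finset.sum_congr rfl fun t _ => ?_
  by_cases h : t i = ti
  · simp only [h, if_true, mul_assoc]
    rw [← Finset.mul_sum, sum_canonRep_mul μ f g Q (Function.update t i ri)
      (fun a => v i t (Function.update a i (α (a i))))]
    simp only [Finset.mul_sum]
    refine Finset.sum_congr rfl fun lam _ => Finset.sum_congr rfl fun s _ => ?_
    congr 3
    · congr 1
      funext j
      by_cases hj : j = i
      · subst hj
        simp
      · simp [hj]
    · congr 1
      funext j
      by_cases hj : j = i
      · subst hj
        simp
      · simp [hj]
  · simp only [h, if_false, mul_assoc]
    rw [← Finset.mul_sum, sum_canonRep_mul]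
    simp only [Finset.mul_sum]
    refine Finset.sum_congr rfl fun lam _ => Finset.sum_congr rfl fun s _ => ?_
    rw [Function.update_eq_self i (fun j => f j (t j) (lam j)),
      Function.update_eq_self i (fun j => g j (t j) (s j) (lam j))]

/-- The canonical representative of a communication equilibrium is a canonical
communication equilibrium. -/
lemma IsCommEq.isCanonCommEq_canonRep {ι : Type} [Fintype ι] [DecidableEq ι]
    {T A R S Λ : ι → Type} [∀ i, Fintype (T i)] [∀ i, DecidableEq (T i)]
    [∀ i, Fintype (A i)] [∀ i, DecidableEq (A i)] [∀ i, Fintype (S i)] [∀ i, Fintype (Λ i)]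
    {P : (∀ i, T i) → ℝ} {v : ι → (∀ i, T i) → (∀ i, A i) → ℝ}
    {μ : ∀ i, Λ i → ℝ}
    {f : ∀ i, T i → Λ i → R i} {g : ∀ i, T i → S i → Λ i → A i}
    {Q : (∀ i, R i) → (∀ i, S i) → ℝ} (hEq : IsCommEq P v μ f g Q) :
    IsCanonCommEq P v (canonRep μ f g Q) := by
  intro i ti ri α
  have hdev := hEq i (fun x l => if x = ti then f i ri l else f i x l)
    (fun x s l => if x = ti then α (g i ri s l) else g i x s l)
  rw [devPayoff_misreport, expPayoff_eq_sum_canonRep, ge_iff_le, ← sub_nonneg] at hdev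
  rw [ge_iff_le, ← sub_nonneg]
  refine hdev.trans_eq ?_
  simp only [← Finset.sum_sub_distrib]
  refine Finset.sum_congr rfl fun t _ => Finset.sum_congr rfl fun a _ => ?_
  split_ifs <;> ring

/-- the canonical representative of a belief-invariant communication
equilibrium is belief-invariant, is a canonical communication equilibrium, and has
the same expected payoffs. -/
theorem stmt3 {ι : Type} [Fintype ι] [DecidableEq ι]
    {T A R S Λ : ι → Type}
    [∀ i, Fintype (T i)] [∀ i, Nonempty (T i)] [∀ i, DecidableEq (T i)]
    [∀ i, Fintype (A i)] [∀ i, Nonempty (A i)] [∀ i, DecidableEq (A i)]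
    [∀ i, Fintype (S i)] [∀ i, DecidableEq (S i)]
    [∀ i, Fintype (Λ i)] [∀ i, Nonempty (Λ i)]
    (P : (∀ i, T i) → ℝ) (v : ι → (∀ i, T i) → (∀ i, A i) → ℝ)
    (μ : ∀ i, Λ i → ℝ)
    (f : ∀ i, T i → Λ i → R i) (g : ∀ i, T i → S i → Λ i → A i)
    (Q : (∀ i, R i) → (∀ i, S i) → ℝ)
    (hP0 : ∀ t, 0 ≤ P t) (hP1 : ∑ t : ∀ i, T i, P t = 1)
    (hμ0 : ∀ i l, 0 ≤ μ i l) (hμ1 : ∀ i, ∑ l : Λ i, μ i l = 1)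
    (hQ : IsCorrelation Q)
    (hBI : IsBeliefInvariant Q)
    (hEq : IsCommEq P v μ f g Q) :
    IsBeliefInvariant (canonRep μ f g Q) ∧
    IsCanonCommEq P v (canonRep μ f g Q) ∧
    ∀ i : ι,
      (∑ t : ∀ j, T j, ∑ a : ∀ j, A j, P t * canonRep μ f g Q t a * v i t a) =
        expPayoff P v μ f g Q i := by
  exact ⟨hBI.canonRep μ f g, hEq.isCanonCommEq_canonRep,
    fun i => (expPayoff_eq_sum_canonRep P v μ f g Q i).symm⟩
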